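/- arXiv:1804.09157 — 7 statements merged into one kernel-verified Lean document; each statement's English description precedes it below -/
import Mathlib

section
/- Let n ≥ 1 and let W⁺, W⁻ be symmetric n×n complex matrices with all entries nonzero satisfying W⁺ x y · W⁻ x y = 1 for all x, y. Let d ∈ ℂ and let V⁺, V⁻ be symmetric n×n complex matrices such that for all a, b ∈ Fin n: V⁺.mulVec Y^{W⁺}_{ab} = (d · V⁻ a b) • Y^{W⁺}_{ab} and V⁻.mulVec Y^{W⁺}_{ab} = (d · V⁺ a b) • Y^{W⁺}_{ab}. Then all four star-triangle identities hold: for all a, b, c ∈ Fin n, (i) ∑_{x} V⁺ x c · W⁺ x a · W⁻ b x = d · V⁻ a b · W⁺ c a · W⁻ b c; (ii) ∑_{x} V⁻ x c · W⁺ x a · W⁻ b x = d · V⁺ a b · W⁺ c a · W⁻ b c; (iii) ∑_{x} V⁺ x c · W⁻ x a · W⁺ b x = d · V⁻ a b · W⁻ c a · W⁺ b c; (iv) ∑_{x} V⁻ x c · W⁻ x a · W⁺ b x = d · V⁺ a b · W⁻ c a · W⁺ b c. -/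
open Matrix BigOperators

/-- An eigenvector equation for the vector of entrywise ratios of two columns of `Wp`, in
star-triangle form. -/
theorem star_triangle_of_mulVec_ratio {ι K : Type*} [Fintype ι] [Field K]
    {Wp Wm V : Matrix ι ι K} (hWm : Wm.IsSymm) (hinv : ∀ x y, Wp x y * Wm x y = 1)
    (hV : V.IsSymm) {a b : ι} {μ : K}
    (h : V.mulVec (fun x => Wp x a / Wp x b) = μ • (fun x => Wp x a / Wp x b)) (c : ι) :
    ∑ x, V x c * Wp x a * Wm b x = μ * Wp c a * Wm b c := by
  have ratio (x : ι) : Wp x a / Wp x b = Wp x a * Wm b x := by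
    rw [div_eq_mul_inv, inv_eq_of_mul_eq_one_right (hinv x b), hWm.apply]
  have hc := congrFun h c
  simp only [Matrix.mulVec, dotProduct, Pi.smul_apply, smul_eq_mul, ratio] at hc
  simpa only [hV.apply, mul_assoc] using hc

/-- All four star-triangle identities for a refined spin model. -/
theorem stmt2 (n : ℕ) (hn : 1 ≤ n) (Wp Wm : Matrix (Fin n) (Fin n) ℂ)
    (hWpsymm : Wp.IsSymm) (hWmsymm : Wm.IsSymm)
    (hWp : ∀ x y, Wp x y ≠ 0) (hWm : ∀ x y, Wm x y ≠ 0)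
    (hinv : ∀ x y, Wp x y * Wm x y = 1)
    (d : ℂ) (Vp Vm : Matrix (Fin n) (Fin n) ℂ)
    (hVpsymm : Vp.IsSymm) (hVmsymm : Vm.IsSymm)
    (hVp : ∀ a b : Fin n,
      Vp.mulVec (fun x => Wp x a / Wp x b) = (d * Vm a b) • (fun x => Wp x a / Wp x b))
    (hVm : ∀ a b : Fin n,
      Vm.mulVec (fun x => Wp x a / Wp x b) = (d * Vp a b) • (fun x => Wp x a / Wp x b)) :
    ∀ a b c : Fin n,
      (∑ x, Vp x c * Wp x a * Wm b x = d * Vm a b * Wp c a * Wm b c) ∧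
      (∑ x, Vm x c * Wp x a * Wm b x = d * Vp a b * Wp c a * Wm b c) ∧
      (∑ x, Vp x c * Wm x a * Wp b x = d * Vm a b * Wm c a * Wp b c) ∧
      (∑ x, Vm x c * Wm x a * Wp b x = d * Vp a b * Wm c a * Wp b c) := by
  intro a b c
  have key {V : Matrix (Fin n) (Fin n) ℂ} (hV : V.IsSymm) {a b : Fin n} {μ : ℂ}
      (h : V.mulVec (fun x => Wp x a / Wp x b) = μ • (fun x => Wp x a / Wp x b)) :=
    star_triangle_of_mulVec_ratio hWmsymm hinv hV h c
  have swap {V : Matrix (Fin n) (Fin n) ℂ} {μ : ℂ}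
      (h : ∑ x, V x c * Wp x b * Wm a x = μ * Wp c b * Wm a c) :
      ∑ x, V x c * Wm x a * Wp b x = μ * Wm c a * Wp b c := by
    simpa only [hWpsymm.apply, hWmsymm.apply, mul_right_comm] using h
  refine ⟨key hVpsymm (hVp a b), key hVmsymm (hVm a b), ?_, ?_⟩
  · rw [← hVmsymm.apply a b]
    exact swap (key hVpsymm (hVp b a))
  · rw [← hVpsymm.apply a b]
    exact swap (key hVmsymm (hVm b a))
end

section
/- Let n ≥ 2, let ξ ∈ ℂ be nonzero, set d = −ξ² − ξ⁻², and assume d² = n. Let W⁺ be the Potts matrix on Fin n with parameter ξ and W⁻ its Hadamard inverse. Then (W⁺, d) is a spin model, i.e. for all a, b ∈ Fin n: W⁺.mulVec Y^{W⁺}_{ab} = (d · W⁻ a b) • Y^{W⁺}_{ab}, where Y^{W⁺}_{ab}(x) = W⁺ x a / W⁺ x b. -/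
open Matrix BigOperators

/-- A matrix with constant diagonal `p` and constant off-diagonal `q` acts on a vector by
`v ↦ (p - q) v + q (∑ v)`. -/
lemma mulVec_of_ite_diag {ι R : Type*} [Fintype ι] [DecidableEq ι] [CommRing R]
    (p q : R) (v : ι → R) (x : ι) :
    (Matrix.of fun a b : ι => if a = b then p else q).mulVec v x
      = (p - q) * v x + q * ∑ y, v y := by
  have h : ∀ y, (if x = y then p else q) * v y
      = (if x = y then (p - q) * v y else 0) + q * v y := by
    intro y
    split_ifs <;> ring
  simp [Matrix.mulVec, dotProduct, h, Finset.sum_add_distrib, Finset.mul_sum]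

/-- The Potts pair `(W⁺, d)` with `d = -ξ² - ξ⁻²`, `d² = n`, is a spin model. -/
theorem stmt3 (n : ℕ) (hn : 2 ≤ n) (ξ : ℂ) (hξ : ξ ≠ 0)
    (d : ℂ) (hd : d = -ξ ^ 2 - (ξ ^ 2)⁻¹) (hdn : d ^ 2 = n)
    (Wp Wm : Matrix (Fin n) (Fin n) ℂ)
    (hWp : Wp = Matrix.of fun a b => if a = b then -(ξ ^ 3)⁻¹ else ξ)
    (hWm : Wm = Matrix.of fun a b => if a = b then -ξ ^ 3 else ξ⁻¹) :
    ∀ a b : Fin n, Wp.mulVec (fun x => Wp x a / Wp x b)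
      = (d * Wm a b) • (fun x => Wp x a / Wp x b) := by
  intro a b
  have hn' : (n : ℂ) = ξ ^ 4 + 2 + (ξ ^ 4)⁻¹ := by
    rw [← hdn, hd]
    field_simp
    ring
  have hY : ∀ x, Wp x a / Wp x b = if a = b then 1 else
      1 + (if x = a then -(ξ ^ 4)⁻¹ - 1 else 0) + (if x = b then -ξ ^ 4 - 1 else 0) := by
    intro x
    by_cases hab : a = b
    · subst hab
      by_cases hx : x = a <;> simp [hWp, hx, hξ]
    · by_cases hxa : x = a
      · subst hxa
        simp only [hWp, Matrix.of_apply, hab, if_true, if_false]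
        field_simp
        ring
      · by_cases hxb : x = b
        · subst hxb
          simp only [hWp, Matrix.of_apply, hxa, hab, if_true, if_false]
          field_simp
          ring
        · simp [hWp, hxa, hxb, hab, hξ]
  simp only [hY]
  ext x
  rw [hWp, mulVec_of_ite_diag]
  by_cases hab : a = b
  · simp only [hab, hWm, hd, hn', Matrix.of_apply, if_true, Finset.sum_const, Finset.card_univ,
      Fintype.card_fin, nsmul_eq_mul, Pi.smul_apply, smul_eq_mul]
    field_simp
    ring
  · have hsum : ∑ y : Fin n, ((1 : ℂ) + (if y = a then -(ξ ^ 4)⁻¹ - 1 else 0)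
        + (if y = b then -ξ ^ 4 - 1 else 0)) = 0 := by
      simp only [Finset.sum_add_distrib, Finset.sum_ite_eq', Finset.mem_univ, if_true,
        Finset.sum_const, Finset.card_univ, Fintype.card_fin, nsmul_eq_mul, hn']
      ring
    have hval : -(ξ ^ 3)⁻¹ - ξ = d * ξ⁻¹ := by
      rw [hd]
      field_simp
      ring
    simp only [hab, if_false, hsum, hval, hWm, Matrix.of_apply, Pi.smul_apply, smul_eq_mul]
    ring
end

section
/- Let n ≥ 2, let ξ ∈ ℂ be nonzero, and assume (−ξ² − ξ⁻²)² = n. Let W⁺ be the Potts matrix on Fin n with parameter ξ. Then for all a, b ∈ Fin n with a ≠ b one has ∑_{x} W⁺ x a / W⁺ x b = 0. -/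
open Matrix BigOperators

/-- For the Potts matrix, the vectors `Y^{W⁺}_{ab}` with `a ≠ b` have zero coordinate sum. -/
theorem stmt4 (n : ℕ) (hn : 2 ≤ n) (ξ : ℂ) (hξ : ξ ≠ 0)
    (hdn : (-ξ ^ 2 - (ξ ^ 2)⁻¹) ^ 2 = n)
    (Wp : Matrix (Fin n) (Fin n) ℂ)
    (hWp : Wp = Matrix.of fun a b => if a = b then -(ξ ^ 3)⁻¹ else ξ) :
    ∀ a b : Fin n, a ≠ b → ∑ x, Wp x a / Wp x b = 0 := by
  intro a b hab
  have entry_ratio : ∀ x, Wp x a / Wp x b =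
      1 + (if x = a then -(ξ ^ 4)⁻¹ - 1 else 0) + (if x = b then -ξ ^ 4 - 1 else 0) := by
    intro x
    simp only [hWp, Matrix.of_apply]
    by_cases hxa : x = a
    · have hxb : x ≠ b := fun h => hab (hxa.symm.trans h)
      simp only [if_pos hxa, if_neg hxb]
      field_simp
      ring
    · by_cases hxb : x = b
      · simp only [if_neg hxa, if_pos hxb]
        field_simp
        ring
      · simp [hxa, hxb, hξ]
  simp only [entry_ratio, Finset.sum_add_distrib, Finset.sum_ite_eq', Finset.mem_univ, if_true,
    Finset.sum_const, Finset.card_univ, Fintype.card_fin, nsmul_eq_mul, mul_one, ← hdn]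
  field_simp
  ring
end

section
/- Let ξ ∈ ℂ be nonzero with (−ξ² − ξ⁻²)² = 3, and let W⁺ be the Potts matrix on Fin 3 with parameter ξ. For α, β ∈ ℂ let V = α·I + β·(J − I), where J is the all-ones 3×3 matrix. Then for all c, e ∈ Fin 3, the vector Y^{W⁺}_{ce} is an eigenvector of V: V.mulVec Y^{W⁺}_{ce} = λ • Y^{W⁺}_{ce}, where λ = α + 2β if c = e and λ = α − β if c ≠ e. (Equivalently, V belongs to the Nomura algebra of W⁺ with ψ(V) = (α+2β)·I + (α−β)·(J−I).) -/
open Matrix BigOperators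

/-- The matrix `α·I + β·(J - I)` acts on `y` as `(α - β)·y + β·(∑ y)`. -/
theorem mulVec_of_ite_eq (α β : ℂ) (y : Fin 3 → ℂ) :
    (Matrix.of fun a b : Fin 3 => if a = b then α else β).mulVec y
      = fun x => (α - β) * y x + β * ∑ z, y z := by
  funext x
  fin_cases x <;> simp [Matrix.mulVec, dotProduct, Fin.sum_univ_three] <;> ring

/-- At the Potts parameter for three spins, the two entry ratios and `1` sum to zero. -/
theorem potts_ratio_add_ratio_inv_add_one {ξ : ℂ} (hξ : ξ ≠ 0)
    (hdn : (-ξ ^ 2 - (ξ ^ 2)⁻¹) ^ 2 = 3) :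
    -(ξ ^ 3)⁻¹ / ξ + ξ / -(ξ ^ 3)⁻¹ + 1 = 0 := by
  field_simp at hdn ⊢
  linear_combination -hdn

/-- For the Potts model on `Fin 3`, every matrix `α·I + β·(J - I)` lies in the Nomura
algebra, with eigenvalue `α + 2β` on `Y_{cc}` and `α - β` on `Y_{ce}` for `c ≠ e`. -/
theorem stmt6 (ξ : ℂ) (hξ : ξ ≠ 0) (hdn : (-ξ ^ 2 - (ξ ^ 2)⁻¹) ^ 2 = 3)
    (Wp : Matrix (Fin 3) (Fin 3) ℂ)
    (hWp : Wp = Matrix.of fun a b => if a = b then -(ξ ^ 3)⁻¹ else ξ)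
    (α β : ℂ) (V : Matrix (Fin 3) (Fin 3) ℂ)
    (hV : V = Matrix.of fun a b => if a = b then α else β) :
    ∀ c e : Fin 3, V.mulVec (fun x => Wp x c / Wp x e)
      = (if c = e then α + 2 * β else α - β) • (fun x => Wp x c / Wp x e) := by
  subst hWp hV
  have hsum := potts_ratio_add_ratio_inv_add_one hξ hdn
  have hp : -(ξ ^ 3)⁻¹ ≠ 0 := neg_ne_zero.mpr (inv_ne_zero (pow_ne_zero 3 hξ))
  simp only [Matrix.of_apply]
  generalize -(ξ ^ 3)⁻¹ = p at hsum hp ⊢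
  intro c e
  rw [mulVec_of_ite_eq]
  by_cases hce : c = e
  · subst hce
    have hone : ∀ x, (if x = c then p else ξ) / (if x = c then p else ξ) = 1 := fun x =>
      div_self (by split_ifs <;> assumption)
    funext x
    simp only [hone, Pi.smul_apply, smul_eq_mul, if_true, Fin.sum_univ_three]
    ring
  · have hzero : ∑ x, (if x = c then p else ξ) / (if x = e then p else ξ) = 0 := by
      rw [Fin.sum_univ_three]
      fin_cases c <;> fin_cases e <;> simp [hξ] at hce ⊢ <;> linear_combination hsum
    funext x
    simp [hzero, hce]
end

section
/- Let ω = exp(2πi/5) and define the pentagonal matrix W⁺ on X = ZMod 5 by W⁺ a b = ω^(((a−b)²).val), with Hadamard inverse W⁻ a b = (W⁺ a b)⁻¹. Then (W⁺, √5) is a spin model: for all a, b ∈ ZMod 5, W⁺.mulVec Y^{W⁺}_{ab} = (√5 · W⁻ a b) • Y^{W⁺}_{ab}, where Y^{W⁺}_{ab}(x) = W⁺ x a / W⁺ x b. -/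
open Matrix BigOperators

theorem ZMod.stdAddChar_eq_exp_pow_val (N : ℕ) [NeZero N] (j : ZMod N) :
    ZMod.stdAddChar j = Complex.exp (2 * Real.pi * Complex.I / N) ^ j.val := by
  rw [← Complex.exp_nat_mul, ZMod.stdAddChar_apply, ZMod.toCircle_apply]
  congr 1
  ring

theorem Complex.exp_two_pi_mul_I_div_five_add_inv :
    exp (2 * Real.pi * I / 5) + (exp (2 * Real.pi * I / 5))⁻¹ = ((√5 - 1) / 2 : ℝ) := by
  have hcos : Real.cos (2 * Real.pi / 5) = (√5 - 1) / 4 := by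
    rw [show 2 * Real.pi / 5 = 2 * (Real.pi / 5) by ring, Real.cos_two_mul,
      Real.cos_pi_div_five]
    have h5 : √5 ^ 2 = 5 := Real.sq_sqrt (by norm_num)
    linear_combination h5 / 8
  have harg : (2 * Real.pi * I / 5 : ℂ) = ((2 * Real.pi / 5 : ℝ) : ℂ) * I := by
    push_cast
    ring
  rw [← exp_neg, harg, ← neg_mul, ← two_cos, ← ofReal_cos, hcos]
  push_cast
  ring

/-- The quadratic Gauss sum modulo `5`. -/
theorem ZMod.sum_stdAddChar_sq_five :
    ∑ z : ZMod 5, ZMod.stdAddChar (z ^ 2) = (√5 : ℂ) := by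
  have hsum : ∑ z : ZMod 5, ZMod.stdAddChar (z ^ 2)
      = 1 + 2 * (ZMod.stdAddChar (1 : ZMod 5) + (ZMod.stdAddChar (1 : ZMod 5))⁻¹) := by
    rw [← AddChar.map_neg_eq_inv]
    refine (Fin.sum_univ_five _).trans ?_
    change ZMod.stdAddChar (0 : ZMod 5) + ZMod.stdAddChar (1 : ZMod 5)
      + ZMod.stdAddChar (-1 : ZMod 5) + ZMod.stdAddChar (-1 : ZMod 5)
      + ZMod.stdAddChar (1 : ZMod 5) = _
    rw [AddChar.map_zero_eq_one]
    ring
  have hone : ZMod.stdAddChar (1 : ZMod 5) = Complex.exp (2 * Real.pi * Complex.I / 5) := by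
    simpa [ZMod.val_one''] using ZMod.stdAddChar_eq_exp_pow_val 5 1
  rw [hsum, hone, Complex.exp_two_pi_mul_I_div_five_add_inv]
  push_cast
  ring

/-- The pentagonal pair `(W⁺, √5)` is a spin model. -/
theorem stmt7 (ω : ℂ) (hω : ω = Complex.exp (2 * Real.pi * Complex.I / 5))
    (Wp Wm : Matrix (ZMod 5) (ZMod 5) ℂ)
    (hWp : Wp = Matrix.of fun a b => ω ^ (((a - b) ^ 2 : ZMod 5).val))
    (hWm : Wm = Matrix.of fun a b => (Wp a b)⁻¹) :
    ∀ a b : ZMod 5, Wp.mulVec (fun x => Wp x a / Wp x b)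
      = ((Real.sqrt 5 : ℂ) * Wm a b) • (fun x => Wp x a / Wp x b) := by
  intro a b
  have hchar (x y : ZMod 5) : Wp x y = ZMod.stdAddChar ((x - y) ^ 2) := by
    rw [hWp, hω, ZMod.stdAddChar_eq_exp_pow_val]
    simp
  ext x
  simp only [Matrix.mulVec, dotProduct, Pi.smul_apply, smul_eq_mul, hWm, Matrix.of_apply, hchar]
  simp only [← AddChar.map_sub_eq_div, ← AddChar.map_neg_eq_inv, ← AddChar.map_add_eq_mul]
  rw [← ZMod.sum_stdAddChar_sq_five, mul_assoc, ← AddChar.map_add_eq_mul, Finset.sum_mul]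
  refine Fintype.sum_equiv (Equiv.subRight (x + a - b)) _ _ fun y => ?_
  rw [← AddChar.map_add_eq_mul, Equiv.subRight_apply]
  congr 1
  ring
end

section
/- Let ω = exp(2πi/5), let W⁺ be the pentagonal matrix on ZMod 5 (W⁺ a b = ω^(((a−b)²).val)), and let A₁, A₂ be the 0–1 matrices on ZMod 5 defined by A₁ a b = 1 if a − b ∈ {1, 4} and 0 otherwise, and A₂ a b = 1 if a − b ∈ {2, 3} and 0 otherwise. Then A₁ and A₂ belong to the Nomura algebra of W⁺: for every a, b ∈ ZMod 5 there exist λ₁, λ₂ ∈ ℂ such that A₁.mulVec Y^{W⁺}_{ab} = λ₁ • Y^{W⁺}_{ab} and A₂.mulVec Y^{W⁺}_{ab} = λ₂ • Y^{W⁺}_{ab}. -/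
open Matrix BigOperators

theorem circulant_mulVec_smul_addChar {G R : Type*} [AddCommGroup G] [Fintype G] [CommRing R]
    (f : G → R) (ψ : AddChar G R) (c : R) :
    (circulant f).mulVec (c • ⇑ψ) = (∑ z, f z * ψ (-z)) • (c • ⇑ψ) := by
  ext x
  simp only [mulVec, dotProduct, circulant_apply, Pi.smul_apply, smul_eq_mul, Finset.sum_mul]
  refine Fintype.sum_equiv (Equiv.subLeft x) _ _ fun y => ?_
  have h : ψ y = ψ (-(x - y)) * ψ x := by rw [← AddChar.map_add_eq_mul]; congr 1; abel
  rw [Equiv.subLeft_apply, h]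
  ring

theorem addChar_sq_sub_div {S K : Type*} [CommRing S] [Field K] (χ : AddChar S K) (a b : S) :
    (fun x => χ ((x - a) ^ 2) / χ ((x - b) ^ 2)) =
      χ (a ^ 2 - b ^ 2) • ⇑(χ.mulShift (2 * (b - a))) := by
  ext x
  simp only [Pi.smul_apply, smul_eq_mul, AddChar.mulShift_apply]
  rw [← AddChar.map_sub_eq_div, ← AddChar.map_add_eq_mul]
  congr 1
  ring

/-- The adjacency matrices `A₁`, `A₂` of the pentagon and pentagram belong to the Nomura
algebra of the pentagonal spin model. -/
theorem stmt8 (ω : ℂ) (hω : ω = Complex.exp (2 * Real.pi * Complex.I / 5))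
    (Wp : Matrix (ZMod 5) (ZMod 5) ℂ)
    (hWp : Wp = Matrix.of fun a b => ω ^ (((a - b) ^ 2 : ZMod 5).val))
    (A₁ A₂ : Matrix (ZMod 5) (ZMod 5) ℂ)
    (hA₁ : A₁ = Matrix.of fun a b => if a - b = 1 ∨ a - b = 4 then 1 else 0)
    (hA₂ : A₂ = Matrix.of fun a b => if a - b = 2 ∨ a - b = 3 then 1 else 0) :
    ∀ a b : ZMod 5, ∃ l₁ l₂ : ℂ,
      A₁.mulVec (fun x => Wp x a / Wp x b) = l₁ • (fun x => Wp x a / Wp x b) ∧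
      A₂.mulVec (fun x => Wp x a / Wp x b) = l₂ • (fun x => Wp x a / Wp x b) := by
  intro a b
  have hω5 : ω ^ 5 = 1 := by
    rw [hω]
    exact (Complex.isPrimitiveRoot_exp 5 (by norm_num)).pow_eq_one
  have hY : (fun x => Wp x a / Wp x b) =
      AddChar.zmodChar 5 hω5 (a ^ 2 - b ^ 2) •
        ⇑((AddChar.zmodChar 5 hω5).mulShift (2 * (b - a))) := by
    rw [← addChar_sq_sub_div, hWp]
    rfl
  have hC₁ : A₁ = circulant fun z : ZMod 5 => if z = 1 ∨ z = 4 then 1 else 0 := hA₁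
  have hC₂ : A₂ = circulant fun z : ZMod 5 => if z = 2 ∨ z = 3 then 1 else 0 := hA₂
  rw [hY, hC₁, hC₂]
  exact ⟨_, _, circulant_mulVec_smul_addChar _ _ _, circulant_mulVec_smul_addChar _ _ _⟩
end

section
/- Let n ≥ 1 and X = ZMod n. Let V be a finite type, v₀ ∈ V, and let S₁, S₂ ⊆ V satisfy S₁ ∪ S₂ = V and S₁ ∩ S₂ = {v₀}. Let E₁, E₂ be finite types with endpoint maps ν₁, ω₁ : E₁ → V taking values in S₁ and ν₂, ω₂ : E₂ → V taking values in S₂, and translation-invariant edge weights w₁ : E₁ → X → X → ℂ and w₂ : E₂ → X → X → ℂ (that is, wᵢ e (x+1) (y+1) = wᵢ e x y for all e, x, y). Then n · ∑_{σ : V → X} (∏_{e ∈ E₁} w₁ e (σ(ν₁ e)) (σ(ω₁ e))) · (∏_{e ∈ E₂} w₂ e (σ(ν₂ e)) (σ(ω₂ e))) = (∑_{σ₁ : S₁ → X} ∏_{e ∈ E₁} w₁ e (σ₁(ν₁ e)) (σ₁(ω₁ e))) · (∑_{σ₂ : S₂ → X} ∏_{e ∈ E₂} w₂ e (σ₂(ν₂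 e)) (σ₂(ω₂ e))). (This is the gluing formula for partition functions of translation-invariant edge-weight models on graphs joined at one vertex.) -/
open BigOperators

/-- Translation by `1` generates all translations of `ZMod n`. -/
theorem ZMod.apply_add_add_eq_of_apply_add_one {n : ℕ} [NeZero n] {α : Type*}
    {f : ZMod n → ZMod n → α} (hf : ∀ x y, f (x + 1) (y + 1) = f x y) (c x y : ZMod n) :
    f (x + c) (y + c) = f x y := by
  rw [← ZMod.natCast_zmod_val c]
  induction c.val with
  | zero => simp
  | succ k ih => rw [Nat.cast_succ, ← add_assoc, ← add_assoc, hf, ih]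

/-- If `S` and `T` cover `V` and meet exactly in `v₀`, then a pair of states on `S` and `T` is the
same as a state on `V` together with the translation aligning the two states at `v₀`. -/
def glueEquiv {V A : Type*} [DecidableEq V] [AddCommGroup A] {v₀ : V} {S T : Finset V}
    (hcover : ∀ v, v ∈ S ∨ v ∈ T) (hinter : ∀ v, v ∈ S ∧ v ∈ T ↔ v = v₀) :
    A × (V → A) ≃ (S → A) × (T → A) where
  toFun p := (fun v => p.2 v, fun v => p.2 v + p.1)
  invFun q :=
    let c := q.2 ⟨v₀, ((hinter v₀).2 rfl).2⟩ - q.1 ⟨v₀, ((hinter v₀).2 rfl).1⟩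
    (c, fun v => if h : v ∈ S then q.1 ⟨v, h⟩ else q.2 ⟨v, (hcover v).resolve_left h⟩ - c)
  left_inv p := by
    ext v <;> simp
  right_inv q := by
    ext ⟨v, hv⟩
    · simp [hv]
    · by_cases h : v ∈ S
      · obtain rfl := (hinter v).1 ⟨h, hv⟩
        simp [h]
      · simp [h]

/-- Gluing formula for partition functions of translation-invariant edge-weight models
on graphs joined at one vertex. -/
theorem stmt11 (n : ℕ) (hn : 1 ≤ n) [NeZero n]
    (V : Type*) [Fintype V] [DecidableEq V]
    (v₀ : V) (S₁ S₂ : Finset V)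
    (hunion : S₁ ∪ S₂ = Finset.univ) (hinter : S₁ ∩ S₂ = {v₀})
    (E₁ E₂ : Type*) [Fintype E₁] [Fintype E₂]
    (ν₁ ω₁ : E₁ → V) (ν₂ ω₂ : E₂ → V)
    (hν₁ : ∀ e, ν₁ e ∈ S₁) (hω₁ : ∀ e, ω₁ e ∈ S₁)
    (hν₂ : ∀ e, ν₂ e ∈ S₂) (hω₂ : ∀ e, ω₂ e ∈ S₂)
    (w₁ : E₁ → ZMod n → ZMod n → ℂ) (w₂ : E₂ → ZMod n → ZMod n → ℂ)
    (hw₁ : ∀ e x y, w₁ e (x + 1) (y + 1) = w₁ e x y)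
    (hw₂ : ∀ e x y, w₂ e (x + 1) (y + 1) = w₂ e x y) :
    (n : ℂ) * ∑ σ : V → ZMod n,
        (∏ e, w₁ e (σ (ν₁ e)) (σ (ω₁ e))) * (∏ e, w₂ e (σ (ν₂ e)) (σ (ω₂ e)))
      = (∑ σ₁ : ↥S₁ → ZMod n, ∏ e, w₁ e (σ₁ ⟨ν₁ e, hν₁ e⟩) (σ₁ ⟨ω₁ e, hω₁ e⟩))
        * ∑ σ₂ : ↥S₂ → ZMod n, ∏ e, w₂ e (σ₂ ⟨ν₂ e, hν₂ e⟩) (σ₂ ⟨ω₂ e, hω₂ e⟩) := by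
  have hcover : ∀ v, v ∈ S₁ ∨ v ∈ S₂ := fun v => by
    rw [← Finset.mem_union, hunion]
    exact Finset.mem_univ v
  have hmeet : ∀ v, v ∈ S₁ ∧ v ∈ S₂ ↔ v = v₀ := fun v => by
    rw [← Finset.mem_inter, hinter, Finset.mem_singleton]
  rw [Fintype.sum_mul_sum, ← Fintype.sum_prod_type', ← (glueEquiv hcover hmeet).sum_comp,
    Fintype.sum_prod_type]
  simp [glueEquiv, ZMod.apply_add_add_eq_of_apply_add_one (hw₂ _), ZMod.card]
end
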